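/- arXiv:1206.3214 — 2 statements merged into one kernel-verified Lean document; each statement's English description precedes it below -/
import Mathlib

section
/- Let a, b ∈ ℝ and A(x) = (x−a)(x−b). Define g on the interval A([0,1]) = {A(x) : x ∈ [0,1]} by g(α) = max{ H(x) : x ∈ [0,1], A(x) = α }, where H(x) = −x log x − (1−x) log(1−x). Then for every α in A([0,1]) the maximum is attained at the solution x_α of A(x) = α in [0,1] that is closest to 1/2 (i.e. minimizes |x − 1/2| among solutions in [0,1]), and g is continuous on A([0,1]). -/
lemma qs_entropy_fold (x : ℝ) :
    Real.binEntropy x = Real.binEntropy (1/2 - |x - 1/2|) := by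
  rcases le_total x (1/2) with h | h
  · rw [abs_of_nonpos (by linarith)]; congr 1; ring
  · rw [abs_of_nonneg (by linarith), ← Real.binEntropy_one_sub]; congr 1; ring

lemma qs_entropy_le {x y : ℝ} (hy : y ∈ Set.Icc (0 : ℝ) 1)
    (h : |x - 1/2| ≤ |y - 1/2|) : Real.binEntropy y ≤ Real.binEntropy x := by
  rw [qs_entropy_fold x, qs_entropy_fold y]
  have h1 : |y - 1/2| ≤ 1/2 := abs_le.2 ⟨by linarith [hy.1], by linarith [hy.2]⟩
  have h2 := abs_nonneg (x - 1/2)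
  have h3 := abs_nonneg (y - 1/2)
  apply Real.binEntropy_strictMonoOn.monotoneOn
  · constructor <;> norm_num <;> linarith
  · constructor <;> norm_num <;> linarith
  · linarith

/-- A continuous selection of the root closest to `1/2`. -/
lemma qs_selection (a b : ℝ) : ∃ s : ℝ → ℝ, Continuous s ∧
    ∀ y ∈ Set.Icc (0 : ℝ) 1, ∀ α, (y - a) * (y - b) = α →
      s α ∈ Set.Icc (0 : ℝ) 1 ∧ (s α - a) * (s α - b) = α ∧ |s α - 1/2| ≤ |y - 1/2| := by
  have key : ∀ y, (y - a) * (y - b) + (a - b)^2/4 = (y - (a+b)/2)^2 := fun y => by ring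
  rcases le_total ((a+b)/2) (1/2) with hc | hc
  · refine ⟨fun α => (a+b)/2 + √(α + (a-b)^2/4), by fun_prop, ?_⟩
    rintro y ⟨hy0, hy1⟩ α rfl
    simp only [key, Real.sqrt_sq_eq_abs]
    rcases le_total 0 (y - (a+b)/2) with h | h
    · rw [abs_of_nonneg h, add_sub_cancel]
      exact ⟨⟨hy0, hy1⟩, rfl, le_rfl⟩
    · rw [abs_of_nonpos h]
      refine ⟨⟨by linarith, by linarith⟩, by ring, ?_⟩
      rw [abs_of_nonpos (by linarith : y - 1/2 ≤ 0)]
      exact abs_le.2 ⟨by linarith, by linarith⟩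
  · refine ⟨fun α => (a+b)/2 - √(α + (a-b)^2/4), by fun_prop, ?_⟩
    rintro y ⟨hy0, hy1⟩ α rfl
    simp only [key, Real.sqrt_sq_eq_abs]
    rcases le_total 0 (y - (a+b)/2) with h | h
    · rw [abs_of_nonneg h]
      refine ⟨⟨by linarith, by linarith⟩, by ring, ?_⟩
      rw [abs_of_nonneg (by linarith : 0 ≤ y - 1/2)]
      exact abs_le.2 ⟨by linarith, by linarith⟩
    · rw [abs_of_nonpos h, sub_neg_eq_add, add_sub_cancel]
      exact ⟨⟨hy0, hy1⟩, rfl, le_rfl⟩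

/-- (Example 1) Let `A(x) = (x-a)(x-b)` and, on `A([0,1])`, let
`g(α) = max { H(x) : x ∈ [0,1], A(x) = α }` where `H` is the binary entropy function.
Then for every `α ∈ A([0,1])` the maximum is attained at a solution of `A(x) = α` in
`[0,1]` closest to `1/2`, and `g` is continuous on `A([0,1])`. -/
theorem quadratic_spectrum_continuous
    (a b : ℝ) (A : ℝ → ℝ) (hA : ∀ x, A x = (x - a) * (x - b))
    (H : ℝ → ℝ) (hH : ∀ x, H x = -(x * Real.log x) - (1 - x) * Real.log (1 - x))
    (g : ℝ → ℝ) (hg : ∀ α, g α = sSup (H '' {x ∈ Set.Icc (0 : ℝ) 1 | A x = α})) :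
    (∀ α ∈ A '' Set.Icc (0 : ℝ) 1, ∃ x ∈ Set.Icc (0 : ℝ) 1, A x = α ∧
      (∀ y ∈ Set.Icc (0 : ℝ) 1, A y = α → |x - 1/2| ≤ |y - 1/2|) ∧
      (∀ y ∈ Set.Icc (0 : ℝ) 1, A y = α → H y ≤ H x) ∧
      g α = H x) ∧
    ContinuousOn g (A '' Set.Icc (0 : ℝ) 1) := by
  obtain rfl : H = Real.binEntropy := by
    funext x
    rw [hH, Real.binEntropy, Real.log_inv, Real.log_inv]
    ring
  obtain ⟨s, hs, hsel⟩ := qs_selection a b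
  have hmain : ∀ α ∈ A '' Set.Icc (0 : ℝ) 1, s α ∈ Set.Icc (0 : ℝ) 1 ∧ A (s α) = α ∧
      (∀ y ∈ Set.Icc (0 : ℝ) 1, A y = α → |s α - 1/2| ≤ |y - 1/2|) ∧
      (∀ y ∈ Set.Icc (0 : ℝ) 1, A y = α → Real.binEntropy y ≤ Real.binEntropy (s α)) ∧
      g α = Real.binEntropy (s α) := by
    rintro α ⟨x, hx, hxα⟩
    have h0 := hsel x hx α (by rw [← hA]; exact hxα)
    have h1 : A (s α) = α := by rw [hA]; exact h0.2.1
    have h2 : ∀ y ∈ Set.Icc (0 : ℝ) 1, A y = α → |s α - 1/2| ≤ |y - 1/2| :=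
      fun y hy hyα => (hsel y hy α (by rw [← hA]; exact hyα)).2.2
    have h3 : ∀ y ∈ Set.Icc (0 : ℝ) 1, A y = α →
        Real.binEntropy y ≤ Real.binEntropy (s α) :=
      fun y hy hyα => qs_entropy_le hy (h2 y hy hyα)
    refine ⟨h0.1, h1, h2, h3, ?_⟩
    rw [hg]
    refine IsGreatest.csSup_eq ⟨⟨s α, ⟨h0.1, h1⟩, rfl⟩, ?_⟩
    rintro _ ⟨y, ⟨hy, hyα⟩, rfl⟩
    exact h3 y hy hyα
  refine ⟨fun α hα => ⟨s α, hmain α hα⟩, ?_⟩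
  exact (Real.binEntropy_continuous.comp hs).continuousOn.congr
    fun α hα => (hmain α hα).2.2.2.2
end

section
/- Let A(x) = (x − 0.4)(x − 0.7)(x − 0.8), and let x_max ∈ (0,1) denote its local maximum point and x_min its local minimum point (so 1/2 < x_max < x_min < 1), and let x' be the unique point with x' > x_min and A(x') = A(x_max). Define g on [A(0), A(1)] by g(α) = max{ H(x) : x ∈ [0,1], A(x) = α }, where H(x) = −x log x − (1−x) log(1−x). Then g is discontinuous at α_0 = A(x_max): for α slightly below α_0 the maximizer lies in [0, x_max] and g(α) is close to H(x_max), while for α ≥ α_0 near α_0 the maximizer lies in (x', 1] and g(α) is close to H(x'), with H(x') < H(x_max). In particular, there exists a kernel Φ on (Σ_2)^3 of the form Φ(x^{(1)},x^{(2)},x^{(3)}) = φ_1(x^{(1)}_1) φ_2(x^{(2)}_1) φ_3(x^{(3)}_1) for which the multifractal spectrum α ↦ h_top(E_Φ(α)) is discontinuous on L_Φ = {α : E_Φ(α) ≠ ∅}. -/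
open MeasureTheory Filter Topology
open scoped ENNReal NNReal

section Defs

variable {X : Type*} [MetricSpace X]

/-- The Bowen ball `B_n(x, ε)` for the dynamics `T`. -/
def bowenBall (T : X → X) (n : ℕ) (ε : ℝ) (x : X) : Set X :=
  {y | ∀ j < n, dist (T^[j] x) (T^[j] y) < ε}

/-- `H^s_n(Z, ε)`: infimum of `∑ exp(-s n_i)` over countable covers of `Z` by Bowen balls
`B_{n_i}(x_i, ε)` with `n_i ≥ n`. -/
noncomputable def bowenHn (T : X → X) (Z : Set X) (s ε : ℝ) (n : ℕ) : ℝ≥0∞ :=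
  ⨅ (c : ℕ → X × ℕ) (_ : Z ⊆ ⋃ i, bowenBall T (c i).2 ε (c i).1) (_ : ∀ i, n ≤ (c i).2),
    ∑' i, ENNReal.ofReal (Real.exp (-(s * ((c i).2 : ℝ))))

/-- `H^s(Z, ε) = lim_n H^s_n(Z, ε)` (the quantities are nondecreasing in `n`). -/
noncomputable def bowenH (T : X → X) (Z : Set X) (s ε : ℝ) : ℝ≥0∞ :=
  ⨆ n : ℕ, bowenHn T Z s ε n

/-- `h_top(Z, ε)`: the critical value of `s ↦ H^s(Z, ε)`. -/
noncomputable def bowenEnt (T : X → X) (Z : Set X) (ε : ℝ) : ℝ≥0∞ :=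
  ⨅ (s : ℝ≥0) (_ : bowenH T Z s ε = 0), (s : ℝ≥0∞)

/-- Bowen's topological entropy of an arbitrary subset `Z ⊆ X`:
`h_top(Z) = lim_{ε → 0} h_top(Z, ε)`. -/
noncomputable def htop (T : X → X) (Z : Set X) : ℝ≥0∞ :=
  ⨆ (ε : ℝ) (_ : 0 < ε), bowenEnt T Z ε

variable [MeasurableSpace X]

/-- Shannon entropy of the finite measurable partition of `X` induced by `P : X → ι`. -/
noncomputable def partEntropy {ι : Type} [Fintype ι] (μ : Measure X) (P : X → ι) : ℝ :=
  ∑ i : ι, Real.negMulLog ((μ (P ⁻¹' {i})).toReal)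

/-- The measure-theoretic (Kolmogorov–Sinai) entropy `h_μ(T)`: supremum over finite measurable
partitions `P` of `lim_n (1/n) H_μ(P ∨ T⁻¹P ∨ ⋯ ∨ T^{-(n-1)}P)`, the limit being the
infimum by subadditivity. -/
noncomputable def hKS (T : X → X) (μ : Measure X) : ℝ≥0∞ :=
  ⨆ (k : ℕ) (P : X → Fin k) (_ : Measurable P),
    ENNReal.ofReal (⨅ n : ℕ,
      partEntropy μ (fun x => fun j : Fin (n + 1) => P (T^[(j : ℕ)] x)) / (n + 1))

/-- The V-statistics `V_Φ(n, x) = n^{-r} ∑_{1 ≤ i_1, …, i_r ≤ n} Φ(T^{i_1}x, …, T^{i_r}x)`. -/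
noncomputable def Vstat {r : ℕ} (T : X → X) (Φ : (Fin r → X) → ℝ) (n : ℕ) (x : X) : ℝ :=
  (∑ i : Fin r → Fin n, Φ (fun j => T^[(i j : ℕ) + 1] x)) / (n : ℝ) ^ r

/-- The level set `E_Φ(α) = {x : lim_n V_Φ(n,x) = α}`. -/
def Eset {r : ℕ} (T : X → X) (Φ : (Fin r → X) → ℝ) (α : ℝ) : Set X :=
  {x | Tendsto (fun n => Vstat T Φ n x) atTop (𝓝 α)}

/-- The fiber `M_Φ(α)`: the `T`-invariant Borel probability measures `μ` with
`∫_{X^r} Φ dμ^{⊗r} = α`. -/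
def Mset {r : ℕ} (T : X → X) (Φ : (Fin r → X) → ℝ) (α : ℝ) : Set (Measure X) :=
  {μ | IsProbabilityMeasure μ ∧ MeasurePreserving T μ μ ∧
    ∫ y, Φ y ∂(Measure.pi fun _ : Fin r => μ) = α}

end Defs

section Shift

/- The metric `d(x,y) = (1/2)^{min {n : x_n ≠ y_n}}` on the symbolic space
`Σ_m = {0, …, m-1}^ℕ`; its topology is the product topology. -/
attribute [local instance] PiNat.metricSpace

/-- The shift map `σ` on `Σ_m = {0, …, m-1}^ℕ`. -/
def shift (m : ℕ) : (ℕ → Fin m) → (ℕ → Fin m) := fun x n => x (n + 1)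

theorem cubic_partA
    (A : ℝ → ℝ) (hA : ∀ x, A x = (x - 0.4) * (x - 0.7) * (x - 0.8))
    (xmax xmin : ℝ) (hmax : IsLocalMax A xmax) (hmin : IsLocalMin A xmin)
    (h1 : 1/2 < xmax) (h2 : xmax < xmin) (h3 : xmin < 1)
    (x' : ℝ) (hx'1 : xmin < x') (hx'2 : A x' = A xmax)
    (H : ℝ → ℝ) (hH : ∀ x, H x = -(x * Real.log x) - (1 - x) * Real.log (1 - x))
    (g : ℝ → ℝ) (hg : ∀ α, g α = sSup (H '' {x ∈ Set.Icc (0 : ℝ) 1 | A x = α})) :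
    H x' < H xmax ∧
    (∃ δ > 0, ∀ α, A xmax - δ < α → α < A xmax →
      ∀ x ∈ Set.Icc (0 : ℝ) 1, A x = α →
        (∀ y ∈ Set.Icc (0 : ℝ) 1, A y = α → H y ≤ H x) → x ∈ Set.Icc 0 xmax) ∧
    Filter.Tendsto g (nhdsWithin (A xmax) (Set.Iio (A xmax))) (nhds (H xmax)) ∧
    (∃ δ > 0, ∀ α, A xmax < α → α < A xmax + δ →
      ∀ x ∈ Set.Icc (0 : ℝ) 1, A x = α →
        (∀ y ∈ Set.Icc (0 : ℝ) 1, A y = α → H y ≤ H x) → x ∈ Set.Ioc x' 1) ∧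
    Filter.Tendsto g (nhdsWithin (A xmax) (Set.Ioi (A xmax))) (nhds (H x')) ∧
    ¬ ContinuousWithinAt g (Set.Icc (A 0) (A 1)) (A xmax) := by
  have hHb : H = Real.binEntropy := by
    funext x
    rw [hH, Real.binEntropy, Real.log_inv, Real.log_inv]; ring
  have hHc : Continuous H := hHb ▸ Real.binEntropy_continuous
  have hanti : StrictAntiOn H (Set.Icc (1/2) 1) := by
    have := Real.binEntropy_strictAntiOn
    rw [hHb]; rwa [one_div]
  have hAf : A = fun x => (x - 0.4) * (x - 0.7) * (x - 0.8) := funext hA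
  have hAc : Continuous A := by rw [hAf]; fun_prop
  have hder : ∀ x, HasDerivAt A (3*x^2 - 3.8*x+1.16) x := by
    intro x
    rw [hAf]
    have := (((hasDerivAt_id x).sub_const 0.4).mul ((hasDerivAt_id x).sub_const 0.7)).mul
      ((hasDerivAt_id x).sub_const 0.8)
    refine this.congr_deriv ?_
    simp only [id, Pi.mul_apply]; ring
  have d1 := hmax.hasDerivAt_eq_zero (hder xmax)
  have d2 := hmin.hasDerivAt_eq_zero (hder xmin)
  set m := xmax with hm
  have hsum : m + xmin = 3.8/3 := by
    have : (xmin - m) * (m + xmin - 3.8/3) = 0 := by linear_combination (d2 - d1)/3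
    rcases mul_eq_zero.1 this with h | h <;> linarith
  have hx's : x' = 1.9 - 2*m := by
    have h0 : (x' - m)^2 * (x' - (1.9 - 2*m)) = 0 := by
      rw [hA, hA] at hx'2
      linear_combination hx'2 - (x' - m) * d1
    have : x' - m ≠ 0 := by linarith
    have := (mul_eq_zero.1 h0).resolve_left (pow_ne_zero 2 this)
    linarith
  have hfac : ∀ x, A x - A m = (x - m)^2 * (x - x') := by
    intro x
    rw [hx's, hA, hA]
    linear_combination (x - m) * d1
  have hx'lt : x' < 1 := by linarith
  have hmx : m < x' := by linarith
  have ivt : ∀ a b α, a ≤ b → A a ≤ α → α ≤ A b → ∃ y ∈ Set.Icc a b, A y = α := by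
    intro a b α hab h h'
    have := intermediate_value_Icc hab hAc.continuousOn ⟨h, h'⟩
    exact this
  have hincl : ∀ x y, x < y → y ≤ m → A x < A y := by
    have key : StrictMonoOn A (Set.Iic m) := by
      apply strictMonoOn_of_deriv_pos (convex_Iic m) hAc.continuousOn
      intro x hx
      rw [interior_Iic] at hx
      rw [(hder x).deriv]
      have hx : x < m := hx
      have : 3*x^2 - 3.8*x+1.16 = 3 * ((m - x) * (xmin - x)) := by
        have : xmin = 3.8/3 - m := by linarith
        rw [this]; linear_combination d1
      rw [this]
      have := mul_pos (sub_pos.2 hx) (sub_pos.2 (hx.trans h2))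
      linarith
    intro x y hxy hy
    exact key (hxy.le.trans hy) hy hxy
  have hHx : H x' < H m := hanti ⟨h1.le, by linarith⟩ ⟨by linarith, hx'lt.le⟩ hmx
  have hleft : ∀ b α, 1/2 ≤ b → b < m → A b < α → α < A m → H m ≤ g α ∧ g α ≤ H b := by
    intro b α hb hbm hα1 hα2
    obtain ⟨y, hy, hyα⟩ := ivt b m α hbm.le hα1.le hα2.le
    have hub : ∀ z ∈ H '' {x ∈ Set.Icc (0 : ℝ) 1 | A x = α}, z ≤ H b := by
      rintro _ ⟨x, ⟨⟨hx0, hx1⟩, hx⟩, rfl⟩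
      have hbx : b ≤ x := by
        by_contra hlt
        have := hincl x b (not_le.1 hlt) hbm.le
        linarith
      exact hanti.antitoneOn ⟨hb, by linarith⟩ ⟨by linarith, hx1⟩ hbx
    have hmem : H y ∈ H '' {x ∈ Set.Icc (0 : ℝ) 1 | A x = α} :=
      ⟨y, ⟨⟨by linarith [hy.1], by linarith [hy.2]⟩, hyα⟩, rfl⟩
    rw [hg]
    refine ⟨le_trans ?_ (le_csSup ⟨_, hub⟩ hmem), csSup_le ⟨_, hmem⟩ hub⟩
    exact hanti.antitoneOn ⟨by linarith [hy.1], by linarith [hy.2]⟩ ⟨by linarith, by linarith⟩ hy.2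
  have hgt : ∀ x, A m < A x → x' < x := by
    intro x hx
    by_contra hle
    have := hfac x
    nlinarith [sq_nonneg (x - m)]
  have hAx' : ∀ b, x' < b → A m < A b := by
    intro b hb
    have := hfac b
    have : 0 < (b - m)^2 * (b - x') := mul_pos (pow_pos (by linarith) 2) (by linarith)
    linarith
  have hright : ∀ b α, x' < b → b ≤ 1 → A m < α → α < A b → H b ≤ g α ∧ g α ≤ H x' := by
    intro b α hb hb1 hα1 hα2
    obtain ⟨y, hy, hyα⟩ := ivt x' b α hb.le (by linarith) hα2.le
    have hub : ∀ z ∈ H '' {x ∈ Set.Icc (0 : ℝ) 1 | A x = α}, z ≤ H x' := by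
      rintro _ ⟨x, ⟨⟨hx0, hx1⟩, hx⟩, rfl⟩
      have := hgt x (by linarith)
      exact hanti.antitoneOn ⟨by linarith, by linarith⟩ ⟨by linarith, hx1⟩ this.le
    have hmem : H y ∈ H '' {x ∈ Set.Icc (0 : ℝ) 1 | A x = α} :=
      ⟨y, ⟨⟨by linarith [hy.1], by linarith [hy.2]⟩, hyα⟩, rfl⟩
    rw [hg]
    refine ⟨le_trans ?_ (le_csSup ⟨_, hub⟩ hmem), csSup_le ⟨_, hmem⟩ hub⟩
    exact hanti.antitoneOn ⟨by linarith [hy.1], by linarith [hy.2]⟩ ⟨by linarith, by linarith⟩ hy.2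
  have hT1 : Filter.Tendsto g (nhdsWithin (A m) (Set.Iio (A m))) (nhds (H m)) := by
    rw [tendsto_order]
    constructor
    · intro a ha
      have hlt := hincl (1/2) m h1 le_rfl
      filter_upwards [Ioo_mem_nhdsLT hlt] with α hα
      exact ha.trans_le (hleft (1/2) α le_rfl h1 hα.1 hα.2).1
    · intro a ha
      have e1 : ∀ᶠ b in 𝓝[<] m, H b < a :=
        (hHc.tendsto m).mono_left nhdsWithin_le_nhds |>.eventually (gt_mem_nhds ha)
      obtain ⟨b, hb, hb2⟩ := (e1.and (Ioo_mem_nhdsLT h1)).exists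
      filter_upwards [Ioo_mem_nhdsLT (hincl b m hb2.2 le_rfl)] with α hα
      exact (hleft b α hb2.1.le hb2.2 hα.1 hα.2).2.trans_lt hb
  have hT2 : Filter.Tendsto g (nhdsWithin (A m) (Set.Ioi (A m))) (nhds (H x')) := by
    rw [tendsto_order]
    constructor
    · intro a ha
      have e1 : ∀ᶠ b in 𝓝[>] x', a < H b :=
        (hHc.tendsto x').mono_left nhdsWithin_le_nhds |>.eventually (lt_mem_nhds ha)
      obtain ⟨b, hb, hb2⟩ := (e1.and (Ioo_mem_nhdsGT hx'lt)).exists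
      filter_upwards [Ioo_mem_nhdsGT (hAx' b hb2.1)] with α hα
      exact hb.trans_le (hright b α hb2.1 hb2.2.le hα.1 hα.2).1
    · intro a ha
      filter_upwards [Ioo_mem_nhdsGT (hAx' 1 hx'lt)] with α hα
      exact (hright 1 α hx'lt le_rfl hα.1 hα.2).2.trans_lt ha
  refine ⟨hHx, ⟨A m - A (1/2), sub_pos.2 (hincl _ _ h1 le_rfl), ?_⟩, hT1, ⟨1, one_pos, ?_⟩, hT2, ?_⟩
  · intro α hα1 hα2 x hx hxα hbest
    refine ⟨hx.1, ?_⟩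
    by_contra hlt
    obtain ⟨y, hy, hyα⟩ := ivt (1/2) m α h1.le (by linarith) hα2.le
    have e1 := hbest y ⟨by linarith [hy.1], by linarith [hy.2]⟩ hyα
    have e2 : H x < H y := hanti ⟨hy.1, by linarith [hy.2]⟩ ⟨by linarith, hx.2⟩
      (by linarith [hy.2])
    linarith
  · intro α hα1 _ x hx hxα _
    exact ⟨hgt x (by linarith), hx.2⟩
  · intro hc
    have hc' : ContinuousAt g (A m) :=
      hc.continuousAt (Icc_mem_nhds (hincl 0 m (by linarith) le_rfl) (hAx' 1 hx'lt))
    have t1 := tendsto_nhds_unique hT1 (hc'.tendsto.mono_left nhdsWithin_le_nhds)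
    have t2 := tendsto_nhds_unique hT2 (hc'.tendsto.mono_left nhdsWithin_le_nhds)
    linarith

lemma shift_iter (x : ℕ → Fin 2) (j i : ℕ) : ((shift 2)^[j] x) i = x (i + j) := by
  induction j generalizing x i with
  | zero => rfl
  | succ j ih => rw [Function.iterate_succ_apply, ih]; rfl

/-- the test kernel, `(x - 1/2)^2 (x - 3/4)`. -/
noncomputable def kerPhi : Fin 3 → Fin 2 → ℝ := fun k b => (b.val : ℝ) - ![1/2, 1/2, 3/4] k

/-- frequency of ones at positions `1..n`. -/
noncomputable def freq (x : ℕ → Fin 2) (n : ℕ) : ℝ := (∑ j : Fin n, ((x (j + 1)).val : ℝ)) / n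

lemma Vstat_eq (x : ℕ → Fin 2) (n : ℕ) (hn : 0 < n) :
    Vstat (shift 2) (fun x : Fin 3 → (ℕ → Fin 2) => ∏ k : Fin 3, kerPhi k (x k 0)) n x
      = (freq x n - 1/2)^2 * (freq x n - 3/4) := by
  have hn' : (n : ℝ) ≠ 0 := by positivity
  have h : ∀ k : Fin 3, (∑ j : Fin n, kerPhi k (x (j + 1))) / n = freq x n - ![1/2, 1/2, 3/4] k := by
    intro k
    simp only [kerPhi, freq, Finset.sum_sub_distrib, Finset.sum_const, Finset.card_univ,
      Fintype.card_fin, nsmul_eq_mul]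
    field_simp
  have h2 : Vstat (shift 2) (fun x : Fin 3 → (ℕ → Fin 2) => ∏ k : Fin 3, kerPhi k (x k 0)) n x
      = ∏ k : Fin 3, ((∑ j : Fin n, kerPhi k (x (j + 1))) / n) := by
    rw [Finset.prod_div_distrib, Finset.prod_univ_sum]
    simp [Vstat, shift_iter, Fintype.piFinset_univ]
  rw [h2]
  simp only [h, Fin.prod_univ_three]
  change (freq x n - 1/2) * (freq x n - 1/2) * (freq x n - 3/4) = _
  ring

lemma mem_Eset_iff (x : ℕ → Fin 2) (α : ℝ) :
    x ∈ Eset (shift 2) (fun x : Fin 3 → (ℕ → Fin 2) => ∏ k : Fin 3, kerPhi k (x k 0)) α ↔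
      Tendsto (fun n => (freq x n - 1/2)^2 * (freq x n - 3/4)) atTop (𝓝 α) := by
  apply tendsto_congr'
  filter_upwards [eventually_gt_atTop 0] with n hn
  exact Vstat_eq x n hn

lemma mem_Eset_of_freq (x : ℕ → Fin 2) (y : ℝ) (h : Tendsto (freq x) atTop (𝓝 y)) :
    x ∈ Eset (shift 2) (fun x : Fin 3 → (ℕ → Fin 2) => ∏ k : Fin 3, kerPhi k (x k 0))
      ((y - 1/2)^2 * (y - 3/4)) := by
  rw [mem_Eset_iff]
  exact ((h.sub_const _).pow 2).mul (h.sub_const _)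

/-- existence of points of any frequency in `(0,1)`. -/
lemma exists_freq (y : ℝ) (h0 : 0 ≤ y) (h1 : y < 1) :
    ∃ x : ℕ → Fin 2, Tendsto (freq x) atTop (𝓝 y) := by
  let F : ℕ → ℕ := fun i => ⌊(i : ℝ) * y⌋₊
  have hF1 : ∀ i, F i ≤ F (i + 1) := by
    intro i
    apply Nat.floor_mono
    push_cast; nlinarith
  have hF2 : ∀ i, F (i + 1) < F i + 2 := by
    intro i
    have a := Nat.lt_floor_add_one ((i : ℝ) * y)
    have b := Nat.floor_le (a := ((i + 1 : ℕ) : ℝ) * y) (by positivity)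
    have : (F (i+1) : ℝ) < F i + 2 := by
      simp only [F]
      push_cast at b ⊢
      linarith
    exact_mod_cast this
  refine ⟨fun i => ⟨F (i + 1) - F i, by have := hF1 i; have := hF2 i; omega⟩, ?_⟩
  have hs : ∀ n : ℕ, (∑ j : Fin n, ((F (j + 1 + 1) - F (j + 1) : ℕ) : ℝ)) = F (n + 1) - F 1 := by
    intro n
    rw [Fin.sum_univ_eq_sum_range (fun j => ((F (j + 1 + 1) - F (j + 1) : ℕ) : ℝ)) n]
    have : ∀ j, ((F (j + 1 + 1) - F (j + 1) : ℕ) : ℝ) = (F (j + 1 + 1) : ℝ) - F (j + 1) := by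
      intro j
      rw [Nat.cast_sub (hF1 _)]
    simp only [this]
    exact Finset.sum_range_sub (fun j => (F (j + 1) : ℝ)) n
  have hF1' : F 1 = 0 := by simp [F, Nat.floor_eq_zero, h1]
  have hfr : ∀ n, freq (fun i => (⟨F (i + 1) - F i, by have := hF1 i; have := hF2 i; omega⟩ : Fin 2)) n
      = (F (n + 1) : ℝ) / n := by
    intro n
    simp only [freq]
    rw [hs, hF1']; simp
  have hinv : Tendsto (fun n : ℕ => (1 : ℝ) / n) atTop (𝓝 0) := tendsto_one_div_atTop_nhds_zero_nat
  have hlo : Tendsto (fun n : ℕ => y - 1 * (1 / (n : ℝ))) atTop (𝓝 y) := by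
    simpa using (tendsto_const_nhds (x := y)).sub (hinv.const_mul 1)
  have hhi : Tendsto (fun n : ℕ => y + 1 * (1 / (n : ℝ))) atTop (𝓝 y) := by
    simpa using (tendsto_const_nhds (x := y)).add (hinv.const_mul 1)
  refine tendsto_of_tendsto_of_tendsto_of_le_of_le' hlo hhi ?_ ?_
  · filter_upwards [eventually_gt_atTop 0] with n hn
    have hn' : (0 : ℝ) < n := by exact_mod_cast hn
    rw [hfr, le_div_iff₀ hn']
    have a := Nat.lt_floor_add_one (((n + 1 : ℕ) : ℝ) * y)
    have e : (y - 1 * (1 / (n : ℝ))) * n = y * n - 1 := by field_simp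
    rw [e]
    simp only [F]; push_cast at a ⊢; linarith
  · filter_upwards [eventually_gt_atTop 0] with n hn
    have hn' : (0 : ℝ) < n := by exact_mod_cast hn
    rw [hfr, div_le_iff₀ hn']
    have b := Nat.floor_le (a := ((n + 1 : ℕ) : ℝ) * y) (by positivity)
    have e : (y + 1 * (1 / (n : ℝ))) * n = y * n + 1 := by field_simp
    rw [e]
    simp only [F]; push_cast at b ⊢; linarith

/-! ### Lower bound -/

/-- fair coin -/
noncomputable def coin : Measure (Fin 2) := (PMF.uniformOfFintype (Fin 2)).toMeasure

instance : IsProbabilityMeasure coin := by unfold coin; infer_instance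

lemma coin_singleton (b : Fin 2) : coin {b} = 2⁻¹ := by
  unfold coin
  rw [PMF.toMeasure_apply_singleton _ _ (measurableSet_singleton _)]
  simp

/-- fair coin measure on sequences -/
noncomputable def coinPi : Measure (ℕ → Fin 2) := Measure.infinitePi (fun _ : ℕ => coin)

instance : IsProbabilityMeasure coinPi := by unfold coinPi; infer_instance

lemma coinPi_cyl (x : ℕ → Fin 2) (n : ℕ) : coinPi {y | ∀ j < n, y j = x j} = 2⁻¹ ^ n := by
  have : {y : ℕ → Fin 2 | ∀ j < n, y j = x j}
      = Set.pi (Finset.range n : Set ℕ) (fun j => {x j}) := by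
    ext y; simp
  rw [this, coinPi, Measure.infinitePi_pi _ (fun _ _ => measurableSet_singleton _)]
  simp [coin_singleton]

lemma coin_slln : ∀ᵐ x ∂coinPi, Tendsto (freq x) atTop (𝓝 (1/2)) := by
  let v : Fin 2 → ℝ := fun b => (b.val : ℝ)
  have hv : Measurable v := measurable_of_finite v
  let X : ℕ → (ℕ → Fin 2) → ℝ := fun i ω => v (ω (i + 1))
  have hXm : ∀ i, Measurable (X i) := fun i => hv.comp (measurable_pi_apply _)
  have hmp : ∀ i, MeasurePreserving (Function.eval i) coinPi coin :=
    fun i => measurePreserving_eval_infinitePi _ i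
  have hint : Integrable (X 0) coinPi :=
    (hmp 1).integrable_comp_of_integrable (g := v) (Integrable.of_finite)
  have hind : ProbabilityTheory.iIndepFun (fun i (ω : ℕ → Fin 2) => v (ω i)) coinPi :=
    ProbabilityTheory.iIndepFun_infinitePi (X := fun _ => v) (fun _ => hv)
  have hid : ∀ i, ProbabilityTheory.IdentDistrib (X i) (X 0) coinPi coinPi := by
    intro i
    refine ⟨(hXm i).aemeasurable, (hXm 0).aemeasurable, ?_⟩
    have : ∀ i, Measure.map (X i) coinPi = Measure.map v coin := by
      intro i
      rw [← (hmp (i+1)).map_eq, Measure.map_map hv (hmp (i+1)).measurable]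
      rfl
    rw [this, this]
  have := ProbabilityTheory.strong_law_ae_real X hint
    (fun i j hij => hind.indepFun (by omega)) hid
  have hmean : ∫ ω, X 0 ω ∂coinPi = 1/2 := by
    have e : ∫ ω, X 0 ω ∂coinPi = ∫ b, v b ∂coin := by
      rw [← (hmp 1).map_eq, integral_map (hmp 1).measurable.aemeasurable
        hv.aestronglyMeasurable]
    rw [e, integral_fintype Integrable.of_finite]
    simp [Measure.real, coin_singleton, v]
  rw [hmean] at this
  filter_upwards [this] with x hx
  refine hx.congr ?_
  intro n
  simp only [freq, X, v]
  rw [Fin.sum_univ_eq_sum_range (fun j => ((x (j + 1)).val : ℝ)) n]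

lemma bowenBall_one_subset (n : ℕ) (x : ℕ → Fin 2) :
    bowenBall (shift 2) n 1 x ⊆ {y | ∀ j < n, y j = x j} := by
  intro y hy j hj
  have h := hy j hj
  have := PiNat.apply_eq_of_dist_lt (n := 0) (by simpa using h) le_rfl
  rw [shift_iter, shift_iter] at this
  simpa using this.symm

lemma htop_lower (Z : Set (ℕ → Fin 2)) (hZ : ∀ᵐ x ∂coinPi, x ∈ Z) :
    ENNReal.ofReal (Real.log 2) ≤ htop (shift 2) Z := by
  refine le_trans ?_ (le_iSup₂ (f := fun (ε : ℝ) (_ : 0 < ε) => bowenEnt (shift 2) Z ε) 1 one_pos)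
  refine le_iInf₂ fun s hs => ?_
  by_contra hlt
  have hlt : (s : ℝ) < Real.log 2 := by
    rw [not_le, ENNReal.lt_ofReal_iff_toReal_lt (by simp)] at hlt
    simpa using hlt
  have hge : (1 : ℝ≥0∞) ≤ bowenHn (shift 2) Z s 1 0 := by
    refine le_iInf fun c => le_iInf fun hc => le_iInf fun _ => ?_
    have hZ1 : coinPi Z = 1 := by
      rw [← measure_univ (μ := coinPi)]
      apply measure_congr
      filter_upwards [hZ] with x hx
      apply propext
      exact ⟨fun _ => trivial, fun _ => hx⟩
    calc (1 : ℝ≥0∞) = coinPi Z := hZ1.symm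
      _ ≤ coinPi (⋃ i, bowenBall (shift 2) (c i).2 1 (c i).1) := measure_mono hc
      _ ≤ ∑' i, coinPi (bowenBall (shift 2) (c i).2 1 (c i).1) := measure_iUnion_le _
      _ ≤ _ := by
        refine ENNReal.tsum_le_tsum fun i => ?_
        refine (measure_mono (bowenBall_one_subset _ _)).trans ?_
        rw [coinPi_cyl]
        have : (2⁻¹ : ℝ≥0∞) ^ (c i).2 = ENNReal.ofReal (2⁻¹ ^ (c i).2) := by
          rw [ENNReal.ofReal_pow (by norm_num), ENNReal.ofReal_inv_of_pos two_pos]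
          simp
        rw [this]
        apply ENNReal.ofReal_le_ofReal
        have : (2⁻¹ : ℝ) ^ (c i).2 = Real.exp (-(Real.log 2 * (c i).2)) := by
          rw [Real.exp_neg, mul_comm, Real.exp_nat_mul, Real.exp_log two_pos, inv_pow]
        rw [this]
        apply Real.exp_le_exp.2
        have := mul_le_mul_of_nonneg_right hlt.le (Nat.cast_nonneg (α := ℝ) (c i).2)
        linarith
  have : (1 : ℝ≥0∞) ≤ bowenH (shift 2) Z s 1 := hge.trans (le_iSup (bowenHn (shift 2) Z s 1) 0)
  rw [hs] at this
  simp at this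

/-! ### Upper bound -/

lemma bowenHn_le {ι : Type} [Countable ι] [Infinite ι] (Z : Set (ℕ → Fin 2)) (s ε : ℝ) (n : ℕ)
    (c : ι → (ℕ → Fin 2) × ℕ) (hc : Z ⊆ ⋃ i, bowenBall (shift 2) (c i).2 ε (c i).1)
    (hn : ∀ i, n ≤ (c i).2) :
    bowenHn (shift 2) Z s ε n ≤ ∑' i, ENNReal.ofReal (Real.exp (-(s * ((c i).2 : ℝ)))) := by
  obtain ⟨e⟩ : Nonempty (ℕ ≃ ι) := nonempty_equiv_of_countable
  rw [← e.tsum_eq]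
  refine iInf_le_of_le (c ∘ e) (iInf_le_of_le ?_ (iInf_le_of_le (fun i => hn _) le_rfl))
  intro x hx
  obtain ⟨i, hi⟩ := Set.mem_iUnion.1 (hc hx)
  exact Set.mem_iUnion.2 ⟨e.symm i, by simpa using hi⟩

lemma mem_bowenBall (n k : ℕ) (ε : ℝ) (hk : (1/2 : ℝ)^k < ε) (x y : ℕ → Fin 2)
    (h : ∀ i < n + k, y i = x i) : y ∈ bowenBall (shift 2) n ε x := by
  intro j hj
  refine lt_of_le_of_lt ?_ hk
  refine PiNat.mem_cylinder_iff_dist_le.1 ?_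
  rw [PiNat.mem_cylinder_iff]
  intro i hi
  rw [shift_iter, shift_iter]
  exact (h _ (by omega)).symm

/-- words of length `n` with at least `3n/4` ones -/
abbrev GoodWord (n : ℕ) : Type :=
  {w : Fin n → Fin 2 // 3 * (n : ℝ) ≤ 4 * ∑ j, ((w j).val : ℝ)}

lemma card_goodWord (n : ℕ) : (Fintype.card (GoodWord n) : ℝ) ≤ (337/192) ^ n := by
  classical
  let f : Fin 2 → ℝ := fun b => (4/3 : ℝ) ^ (4 * (b.val : ℝ) - 3)
  have hsum : ∑ b, f b = 337/192 := by
    have e : ((4/3 : ℝ)) ^ (-3 : ℝ) = 27/64 := by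
      rw [Real.rpow_neg (by norm_num)]
      norm_num
    simp only [f, Fin.sum_univ_two]
    norm_num [e]
  have hpos : ∀ w : Fin n → Fin 2, 0 ≤ ∏ j, f (w j) := fun w =>
    Finset.prod_nonneg fun j _ => Real.rpow_nonneg (by norm_num) _
  rw [← hsum, Finset.sum_pow']
  rw [Fintype.card_subtype, Finset.card_eq_sum_ones, Nat.cast_sum, Fintype.piFinset_univ]
  refine le_trans (Finset.sum_le_sum (g := fun w : Fin n → Fin 2 => ∏ j, f (w j)) ?_)
    (Finset.sum_le_sum_of_subset_of_nonneg (Finset.subset_univ _) fun w _ _ => hpos w)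
  intro w hw
  have hw := (Finset.mem_filter.1 hw).2
  have : ∏ j, f (w j) = (4/3 : ℝ) ^ (∑ j, (4 * ((w j).val : ℝ) - 3)) := by
    rw [Real.rpow_sum_of_pos (by norm_num)]
  rw [this]
  simp only [Nat.cast_one]
  apply Real.one_le_rpow (by norm_num)
  rw [Finset.sum_sub_distrib, ← Finset.mul_sum]
  simp only [Finset.sum_const, Finset.card_univ, Fintype.card_fin, nsmul_eq_mul]
  linarith

lemma htop_upper (Z : Set (ℕ → Fin 2)) (hZ : ∀ x ∈ Z, ∀ᶠ n in atTop, 3/4 < freq x n) :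
    htop (shift 2) Z ≤ ENNReal.ofReal (Real.log (9/5)) := by
  classical
  refine iSup₂_le fun ε hε => ?_
  refine iInf₂_le (Real.log (9/5)).toNNReal ?_
  have hl : ((Real.log (9/5)).toNNReal : ℝ) = Real.log (9/5) :=
    Real.coe_toNNReal _ (Real.log_nonneg (by norm_num))
  rw [hl]
  unfold bowenH
  simp only [ENNReal.iSup_eq_zero]
  intro n
  obtain ⟨k, hk⟩ := exists_pow_lt_of_lt_one hε (by norm_num : (1/2 : ℝ) < 1)
  let r : ℝ≥0∞ := ENNReal.ofReal (1685/1728)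
  have hr : r < 1 := by
    rw [← ENNReal.ofReal_one]
    exact (ENNReal.ofReal_lt_ofReal_iff one_pos).2 (by norm_num)
  let C : ℝ≥0∞ := (2 * 2 ^ k : ℕ)
  have key : ∀ M, n ≤ M → bowenHn (shift 2) Z (Real.log (9/5)) ε n ≤ C * (1 - r)⁻¹ * r ^ M := by
    intro M hM
    let ι := Σ m : ℕ, (GoodWord (M + m) × Fin 2 × (Fin k → Fin 2))
    have hinf : Infinite ι := by
      refine Infinite.of_injective
        (fun m : ℕ => (⟨m, ⟨fun _ => 1, ?_⟩, 0, fun _ => 0⟩ : ι)) ?_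
      · simp
        have : (0 : ℝ) ≤ (M : ℝ) + m := by positivity
        linarith
      · intro a b hab
        exact congrArg Sigma.fst hab
    let ctr : ι → (ℕ → Fin 2) := fun i p =>
      match i with
      | ⟨m, w, a, v⟩ =>
        if p = 0 then a else if h : p - 1 < M + m then w.1 ⟨p - 1, h⟩
          else if h : p - 1 - (M + m) < k then v ⟨p - 1 - (M + m), h⟩ else 0
    refine (bowenHn_le (ι := ι) Z _ ε n (fun i => (ctr i, M + i.1)) ?_ ?_).trans ?_
    · intro x hx
      obtain ⟨N, hN⟩ := eventually_atTop.1 (hZ x hx)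
      have h1 := hN (M + (N + 1)) (by omega)
      have hgood : 3 * ((M + (N + 1) : ℕ) : ℝ)
          ≤ 4 * ∑ j : Fin (M + (N + 1)), ((x (j + 1)).val : ℝ) := by
        unfold freq at h1
        rw [lt_div_iff₀ (by exact_mod_cast (by omega : 0 < M + (N + 1)))] at h1
        linarith
      refine Set.mem_iUnion.2
        ⟨⟨N + 1, ⟨fun j => x (j + 1), hgood⟩, x 0, fun j => x (M + (N + 1) + 1 + j)⟩, ?_⟩
      apply mem_bowenBall _ k _ hk
      intro p hp
      simp only [ctr]
      simp only at hp
      split_ifs with q1 q2 q3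
      · rw [q1]
      · congr 1; omega
      · congr 1; omega
      · omega
    · intro i
      exact hM.trans (Nat.le_add_right _ _)
    · rw [ENNReal.tsum_sigma']
      have : ∀ m : ℕ, (∑' (_ : GoodWord (M + m) × Fin 2 × (Fin k → Fin 2)),
          ENNReal.ofReal (Real.exp (-(Real.log (9/5) * ((M + m : ℕ) : ℝ))))) ≤ C * r ^ M * r ^ m := by
        intro m
        rw [tsum_fintype, Finset.sum_const, Finset.card_univ, Fintype.card_prod, nsmul_eq_mul]
        have hc2 : Fintype.card (Fin 2 × (Fin k → Fin 2)) = 2 * 2 ^ k := by simp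
        rw [hc2, Nat.cast_mul, mul_comm (Nat.cast (Fintype.card _)), mul_assoc, mul_assoc]
        refine mul_le_mul_right ?_ _
        rw [← pow_add, ← ENNReal.ofReal_pow (by norm_num), ← ENNReal.ofReal_natCast,
          ← ENNReal.ofReal_mul (by positivity)]
        apply ENNReal.ofReal_le_ofReal
        have e : Real.exp (-(Real.log (9/5) * ((M + m : ℕ) : ℝ))) = (5/9) ^ (M + m) := by
          rw [Real.exp_neg, mul_comm, Real.exp_nat_mul, Real.exp_log (by norm_num), ← inv_pow]
          norm_num
        rw [e]
        calc _ ≤ (337/192 : ℝ) ^ (M + m) * (5/9) ^ (M + m) :=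
              mul_le_mul_of_nonneg_right (card_goodWord _) (by positivity)
          _ = _ := by rw [← mul_pow]; norm_num
      refine (ENNReal.tsum_le_tsum this).trans ?_
      rw [ENNReal.tsum_mul_left, ENNReal.tsum_geometric]
      exact le_of_eq (by ring)
  have hlim : Tendsto (fun M : ℕ => C * (1 - r)⁻¹ * r ^ M) atTop (𝓝 0) := by
    have hC : C * (1 - r)⁻¹ ≠ ⊤ := by
      apply ENNReal.mul_ne_top (ENNReal.natCast_ne_top _)
      rw [ENNReal.inv_ne_top]
      exact (tsub_pos_of_lt hr).ne'
    have := ENNReal.Tendsto.const_mul (ENNReal.tendsto_pow_atTop_nhds_zero_of_lt_one hr)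
      (Or.inr hC)
    simpa using this
  refine le_antisymm (ge_of_tendsto hlim ?_) bot_le
  filter_upwards [eventually_ge_atTop n] with M hM using key M hM

theorem cubic_partB : ∃ φ : Fin 3 → Fin 2 → ℝ, ∃ α₀ : ℝ,
      (Eset (shift 2) (fun x : Fin 3 → (ℕ → Fin 2) => ∏ k : Fin 3, φ k (x k 0)) α₀).Nonempty ∧
      ¬ ContinuousWithinAt
          (fun α : ℝ => htop (shift 2)
            (Eset (shift 2) (fun x : Fin 3 → (ℕ → Fin 2) => ∏ k : Fin 3, φ k (x k 0)) α))
          {α : ℝ |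
            (Eset (shift 2) (fun x : Fin 3 → (ℕ → Fin 2) => ∏ k : Fin 3, φ k (x k 0)) α).Nonempty}
          α₀ := by
  have hae : ∀ᵐ x ∂coinPi, x ∈
      Eset (shift 2) (fun x : Fin 3 → (ℕ → Fin 2) => ∏ k : Fin 3, kerPhi k (x k 0)) 0 := by
    filter_upwards [coin_slln] with x hx
    have := mem_Eset_of_freq x _ hx
    simpa using this
  refine ⟨kerPhi, 0, hae.exists, fun hc => ?_⟩
  have hlow := htop_lower _ hae
  have hup : ∀ α : ℝ, 0 < α → htop (shift 2)
      (Eset (shift 2) (fun x : Fin 3 → (ℕ → Fin 2) => ∏ k : Fin 3, kerPhi k (x k 0)) α)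
        ≤ ENNReal.ofReal (Real.log (9/5)) := by
    intro α hα
    refine htop_upper _ fun x hx => ?_
    rw [mem_Eset_iff] at hx
    filter_upwards [hx.eventually (lt_mem_nhds hα)] with n hn
    by_contra hle
    nlinarith [sq_nonneg (freq x n - 1/2)]
  have hlog : ENNReal.ofReal (Real.log (9/5)) < ENNReal.ofReal (Real.log 2) :=
    (ENNReal.ofReal_lt_ofReal_iff (Real.log_pos (by norm_num))).2
      (Real.log_lt_log (by norm_num) (by norm_num))
  have hev := hc.tendsto.eventually (lt_mem_nhds (hlog.trans_le hlow))
  let P : ℝ → ℝ := fun y => (y - 1/2)^2 * (y - 3/4)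
  have hP : Tendsto P (𝓝[>] (3/4)) (𝓝 0) := by
    have : Continuous P := by fun_prop
    have h := (this.tendsto (3/4)).mono_left (nhdsWithin_le_nhds (s := Set.Ioi (3/4)))
    simpa [P] using h
  have hIoo : Set.Ioo (3/4 : ℝ) 1 ∈ 𝓝[>] (3/4 : ℝ) := Ioo_mem_nhdsGT (by norm_num)
  have hP2 := tendsto_nhdsWithin_iff.2 ⟨hP, show ∀ᶠ y in 𝓝[>] (3/4 : ℝ), P y ∈ {α : ℝ |
      (Eset (shift 2) (fun x : Fin 3 → (ℕ → Fin 2) => ∏ k : Fin 3, kerPhi k (x k 0)) α).Nonempty} by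
    filter_upwards [hIoo] with y hy
    obtain ⟨x, hx⟩ := exists_freq y (by linarith [hy.1]) hy.2
    exact ⟨x, mem_Eset_of_freq x y hx⟩⟩
  obtain ⟨y, hy, hy2⟩ := ((hP2.eventually hev).and hIoo).exists
  have hpos : 0 < P y :=
    mul_pos (pow_pos (by linarith [hy2.1]) 2) (by linarith [hy2.1])
  exact absurd (hup _ hpos) (not_le.2 hy)


/-- (Example 2, Situation II) Let `A(x) = (x-0.4)(x-0.7)(x-0.8)`, with
local maximum point `x_max` and local minimum point `x_min` satisfying
`1/2 < x_max < x_min < 1`, and let `x' > x_min` be the point with `A(x') = A(x_max)`.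
Let `g(α) = max {H(x) : x ∈ [0,1], A(x) = α}` on `[A(0), A(1)]`, `H` the binary entropy.
Then `H(x') < H(x_max)`; as `α ↑ A(x_max)` the maximizers lie in `[0, x_max]` and
`g(α) → H(x_max)`, while as `α ↓ A(x_max)` the maximizers lie in `(x', 1]` and
`g(α) → H(x')`; hence `g` is discontinuous at `α₀ = A(x_max)`. In particular there is a
product kernel `Φ(x⁽¹⁾,x⁽²⁾,x⁽³⁾) = φ₁(x⁽¹⁾_1) φ₂(x⁽²⁾_1) φ₃(x⁽³⁾_1)` on `(Σ_2)³` whose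
multifractal spectrum `α ↦ h_top(E_Φ(α))` is discontinuous on `L_Φ`. -/
theorem cubic_spectrum_discontinuous
    (A : ℝ → ℝ) (hA : ∀ x, A x = (x - 0.4) * (x - 0.7) * (x - 0.8))
    (xmax xmin : ℝ) (hmax : IsLocalMax A xmax) (hmin : IsLocalMin A xmin)
    (h1 : 1/2 < xmax) (h2 : xmax < xmin) (h3 : xmin < 1)
    (x' : ℝ) (hx'1 : xmin < x') (hx'2 : A x' = A xmax)
    (H : ℝ → ℝ) (hH : ∀ x, H x = -(x * Real.log x) - (1 - x) * Real.log (1 - x))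
    (g : ℝ → ℝ) (hg : ∀ α, g α = sSup (H '' {x ∈ Set.Icc (0 : ℝ) 1 | A x = α})) :
    H x' < H xmax ∧
    (∃ δ > 0, ∀ α, A xmax - δ < α → α < A xmax →
      ∀ x ∈ Set.Icc (0 : ℝ) 1, A x = α →
        (∀ y ∈ Set.Icc (0 : ℝ) 1, A y = α → H y ≤ H x) → x ∈ Set.Icc 0 xmax) ∧
    Filter.Tendsto g (nhdsWithin (A xmax) (Set.Iio (A xmax))) (nhds (H xmax)) ∧
    (∃ δ > 0, ∀ α, A xmax < α → α < A xmax + δ →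
      ∀ x ∈ Set.Icc (0 : ℝ) 1, A x = α →
        (∀ y ∈ Set.Icc (0 : ℝ) 1, A y = α → H y ≤ H x) → x ∈ Set.Ioc x' 1) ∧
    Filter.Tendsto g (nhdsWithin (A xmax) (Set.Ioi (A xmax))) (nhds (H x')) ∧
    ¬ ContinuousWithinAt g (Set.Icc (A 0) (A 1)) (A xmax) ∧
    (∃ φ : Fin 3 → Fin 2 → ℝ, ∃ α₀ : ℝ,
      (Eset (shift 2) (fun x : Fin 3 → (ℕ → Fin 2) => ∏ k : Fin 3, φ k (x k 0)) α₀).Nonempty ∧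
      ¬ ContinuousWithinAt
          (fun α : ℝ => htop (shift 2)
            (Eset (shift 2) (fun x : Fin 3 → (ℕ → Fin 2) => ∏ k : Fin 3, φ k (x k 0)) α))
          {α : ℝ |
            (Eset (shift 2) (fun x : Fin 3 → (ℕ → Fin 2) => ∏ k : Fin 3, φ k (x k 0)) α).Nonempty}
          α₀) := by
  obtain ⟨a1, a2, a3, a4, a5, a6⟩ :=
    cubic_partA A hA xmax xmin hmax hmin h1 h2 h3 x' hx'1 hx'2 H hH g hg
  exact ⟨a1, a2, a3, a4, a5, a6, cubic_partB⟩

end Shift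
end
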